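/- Let K_1, …, K_d be Markov transition kernels on a product space X = X_1 × ⋯ × X_d such that for each i, K_i updates only the i-th coordinate: K_i(x, ·) is supported on {y ∈ X : y_j = x_j for all j ≠ i}. Let r_1, …, r_d > 0 with r_1 + ⋯ + r_d = 1 and define the simple mixing kernel P_mix(x, A) = Σ_{i=1}^d r_i K_i(x, A) and the composition kernel P_comp = K_d ∘ ⋯ ∘ K_1 (the components updated in order 1, 2, …, d). Then for every x ∈ X and every measurable A, the d-step mixing kernel satisfies P_mix^d(x, A) ≥ (∏_{i=1}^d r_i) P_comp(x, A). In particular, if there exist ε > 0 and a probability measure Q such that P_comp(x, A) ≥ ε Q(A) for all x ∈ X and all measurable A (so the composition sampler is uniformly ergodic), then P_mix^d(x, A) ≥ ε (∏_{i=1}^d r_i) Q(A) for all x and A, so the simple mixing algorithm is uniformly ergodic and the total variation distance to stationarity after n × d iterations is bounded above by (1 − ε r_1 ⋯ r_d)^n. -/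

import Mathlib

open MeasureTheory ProbabilityTheory
open scoped ENNReal

/-- The `n`-step Markov transition kernel, obtained by iterated composition of `P`. -/
noncomputable def kIter {X : Type*} [MeasurableSpace X] (P : Kernel X X) : ℕ → Kernel X X
  | 0 => Kernel.id
  | n + 1 => (kIter P n) ∘ₖ P

/-- The composition kernel `K_d ∘ ⋯ ∘ K_1`, updating the components in the order
`1, 2, …, d`. -/
noncomputable def kComp {X : Type*} [MeasurableSpace X] {d : ℕ}
    (K : Fin d → Kernel X X) : Kernel X X :=
  (List.ofFn K).foldl (fun acc κ => κ ∘ₖ acc) Kernel.id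

lemma kIter_add {X : Type*} [MeasurableSpace X] (P : Kernel X X) (m n : ℕ) :
    kIter P (m + n) = kIter P m ∘ₖ kIter P n := by
  induction n with
  | zero => simp [kIter]
  | succ n ih => rw [← add_assoc, kIter, ih, kIter, Kernel.comp_assoc]

lemma kIter_mul {X : Type*} [MeasurableSpace X] (P : Kernel X X) (n d : ℕ) :
    kIter P (n * d) = kIter (kIter P d) n := by
  induction n with
  | zero => simp [kIter]
  | succ n ih => rw [Nat.succ_mul, kIter_add, ih, kIter]

instance isMarkovKernel_kIter {X : Type*} [MeasurableSpace X] (P : Kernel X X)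
    [IsMarkovKernel P] (n : ℕ) : IsMarkovKernel (kIter P n) := by
  induction n with
  | zero => rw [kIter]; infer_instance
  | succ n ih => rw [kIter]; infer_instance

lemma invariant_kIter {X : Type*} [MeasurableSpace X] {P : Kernel X X}
    {π : Measure X} (h : Kernel.Invariant P π) (n : ℕ) : Kernel.Invariant (kIter P n) π := by
  induction n with
  | zero => simp [Kernel.Invariant, kIter]
  | succ n ih => exact ih.comp h

/-- If each kernel `K i` has weight `r i` in `P`, then composing the `K i` along a list costs
the product of the weights compared with iterating `P`. -/
lemma prod_mul_foldl_comp_le_kIter_comp {X ι : Type*} [MeasurableSpace X] {P : Kernel X X}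
    {K : ι → Kernel X X} {r : ι → ℝ≥0∞} (h : ∀ i x, r i • K i x ≤ P x) (l : List ι)
    (κ : Kernel X X) (x : X) {A : Set X} (hA : MeasurableSet A) :
    (l.map r).prod * (l.map K).foldl (fun acc η => η ∘ₖ acc) κ x A ≤
      (kIter P l.length ∘ₖ κ) x A := by
  induction l generalizing κ with
  | nil => simp [kIter]
  | cons i l ih =>
    simp only [List.map_cons, List.prod_cons, List.foldl_cons, List.length_cons]
    calc r i * (l.map r).prod * (l.map K).foldl (fun acc η => η ∘ₖ acc) (K i ∘ₖ κ) x A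
        ≤ r i * (kIter P l.length ∘ₖ (K i ∘ₖ κ)) x A := by
          rw [mul_assoc]
          gcongr
          exact ih _
      _ = ∫⁻ y, r i * (kIter P l.length ∘ₖ K i) y A ∂(κ x) := by
          rw [← Kernel.comp_assoc, Kernel.comp_apply' _ _ _ hA,
            lintegral_const_mul _ (Kernel.measurable_coe _ hA)]
      _ ≤ ∫⁻ y, (kIter P l.length ∘ₖ P) y A ∂(κ x) := by
          refine lintegral_mono fun y => ?_
          rw [Kernel.comp_apply' _ _ _ hA, Kernel.comp_apply' _ _ _ hA, ← smul_eq_mul,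
            ← lintegral_smul_measure]
          exact lintegral_mono' (h i y) le_rfl
      _ = (kIter P (l.length + 1) ∘ₖ κ) x A := by
          rw [kIter, Kernel.comp_apply' _ _ _ hA]

lemma prod_mul_kComp_le_kIter {X : Type*} [MeasurableSpace X] {d : ℕ} {P : Kernel X X}
    {K : Fin d → Kernel X X} {r : Fin d → ℝ≥0∞} (h : ∀ i x, r i • K i x ≤ P x) (x : X)
    {A : Set X} (hA : MeasurableSet A) :
    (∏ i, r i) * kComp K x A ≤ kIter P d x A := by
  have := prod_mul_foldl_comp_le_kIter_comp h (List.finRange d) Kernel.id x hA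
  rwa [← List.ofFn_eq_map, ← List.ofFn_eq_map, List.prod_ofFn, List.length_finRange,
    Kernel.comp_id] at this

lemma integrable_toReal_kernel {X : Type*} [MeasurableSpace X] (κ : Kernel X X)
    [IsMarkovKernel κ] (μ : Measure X) [IsFiniteMeasure μ] {A : Set X} (hA : MeasurableSet A) :
    Integrable (fun x => (κ x A).toReal) μ :=
  Integrable.of_bound (κ.measurable_coe hA).ennreal_toReal.aestronglyMeasurable 1
    (.of_forall fun x => by simpa [Measure.real] using measureReal_le_one (μ := κ x) (s := A))

lemma toReal_comp_apply {X : Type*} [MeasurableSpace X] (κ η : Kernel X X)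
    [IsMarkovKernel κ] (x : X) {A : Set X} (hA : MeasurableSet A) :
    ((κ ∘ₖ η) x A).toReal = ∫ y, (κ y A).toReal ∂(η x) := by
  rw [Kernel.comp_apply' _ _ _ hA, integral_toReal (κ.measurable_coe hA).aemeasurable
    (.of_forall fun y => measure_lt_top _ _)]

/-- Under a one-step minorization, `n` steps reduce the oscillation of the transition
probabilities in the starting point to at most `(1 - δ) ^ n`. -/
lemma exists_forall_kIter_mem_Icc {X : Type*} [MeasurableSpace X] {R : Kernel X X}
    [IsMarkovKernel R] {δ : ℝ≥0∞} {Q : Measure X} [IsProbabilityMeasure Q]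
    (h : ∀ x, δ • Q ≤ R x) (n : ℕ) {A : Set X} (hA : MeasurableSet A) :
    ∃ a : ℝ, ∀ x, (kIter R n x A).toReal ∈ Set.Icc a (a + (1 - δ.toReal) ^ n) := by
  induction n with
  | zero =>
    refine ⟨0, fun x => ⟨ENNReal.toReal_nonneg, ?_⟩⟩
    simpa [Measure.real] using measureReal_le_one (μ := kIter R 0 x) (s := A)
  | succ n ih =>
    obtain ⟨a, ha⟩ := ih
    set f : X → ℝ := fun x => (kIter R n x A).toReal
    set c := (1 - δ.toReal) ^ n
    have hfi (μ : Measure X) [IsFiniteMeasure μ] : Integrable f μ :=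
      integrable_toReal_kernel _ μ hA
    refine ⟨a * (1 - δ.toReal) + δ.toReal * ∫ y, f y ∂Q, fun x => ?_⟩
    have lower : ∫ y, (f y - a) ∂(δ • Q) ≤ ∫ y, (f y - a) ∂(R x) :=
      integral_mono_measure (h x) (.of_forall fun y => sub_nonneg.2 (ha y).1)
        ((hfi _).sub (integrable_const _))
    have upper : ∫ y, (a + c - f y) ∂(δ • Q) ≤ ∫ y, (a + c - f y) ∂(R x) :=
      integral_mono_measure (h x) (.of_forall fun y => sub_nonneg.2 (ha y).2)
        ((integrable_const _).sub (hfi _))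
    rw [integral_smul_measure, integral_sub (hfi _) (integrable_const _),
      integral_sub (hfi _) (integrable_const _)] at lower
    rw [integral_smul_measure, integral_sub (integrable_const _) (hfi _),
      integral_sub (integrable_const _) (hfi _)] at upper
    simp only [integral_const, probReal_univ, smul_eq_mul, one_mul] at lower upper
    rw [kIter, toReal_comp_apply _ _ _ hA, pow_succ]
    change ∫ y, f y ∂(R x) ∈ Set.Icc _ (_ + c * _)
    constructor <;> linarith

/-- Uniform ergodicity from a Doeblin minorization. -/
lemma abs_kIter_sub_invariant_le {X : Type*} [MeasurableSpace X] {R : Kernel X X}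
    [IsMarkovKernel R] {δ : ℝ≥0∞} {Q : Measure X} [IsProbabilityMeasure Q]
    (h : ∀ x, δ • Q ≤ R x) {π : Measure X} [IsProbabilityMeasure π]
    (hinv : Kernel.Invariant R π) (n : ℕ) (x : X) {A : Set X} (hA : MeasurableSet A) :
    |(kIter R n x A).toReal - (π A).toReal| ≤ (1 - δ.toReal) ^ n := by
  obtain ⟨a, ha⟩ := exists_forall_kIter_mem_Icc h n hA
  have hπ : (π A).toReal = ∫ y, (kIter R n y A).toReal ∂π := by
    conv_lhs => rw [← (invariant_kIter hinv n).def]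
    rw [Measure.bind_apply hA (kIter R n).aemeasurable,
      integral_toReal ((kIter R n).measurable_coe hA).aemeasurable
        (.of_forall fun y => measure_lt_top _ _)]
  have hfi := integrable_toReal_kernel (kIter R n) π hA
  have lower : a ≤ (π A).toReal := by
    simpa [hπ] using integral_mono (integrable_const a) hfi fun y => (ha y).1
  have upper : (π A).toReal ≤ a + (1 - δ.toReal) ^ n := by
    simpa [hπ] using integral_mono hfi (integrable_const _) fun y => (ha y).2
  have hx := ha x
  rw [abs_le]
  constructor <;> linarith [hx.1, hx.2]

/-- If `K_1, …, K_d` are component-wise kernels (each `K_i` only changes the `i`-th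
coordinate), `P_mix = Σ r_i K_i` is the simple mixing kernel and
`P_comp = K_d ∘ ⋯ ∘ K_1` the composition kernel, then
`P_mix^d(x,A) ≥ (∏ r_i) P_comp(x,A)`.  In particular a minorization
`P_comp(x,A) ≥ ε Q(A)` yields `P_mix^d(x,A) ≥ ε (∏ r_i) Q(A)`, so the simple mixing
sampler is uniformly ergodic with total variation distance to stationarity after `n × d`
iterations bounded above by `(1 − ε r₁ ⋯ r_d)^n`. -/
theorem mixing_uniformly_ergodic_of_composition
    {d : ℕ} {X : Fin d → Type*} [∀ j, MeasurableSpace (X j)]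
    [∀ j, MeasurableSingletonClass (X j)]
    (K : Fin d → Kernel (∀ j, X j) (∀ j, X j)) [∀ i, IsMarkovKernel (K i)]
    -- `K i` updates only the `i`-th coordinate
    (hsupp : ∀ (i : Fin d) (x : ∀ j, X j),
      K i x {y : ∀ j, X j | ∀ j : Fin d, j ≠ i → y j = x j}ᶜ = 0)
    (r : Fin d → ℝ≥0∞) (hr : ∀ i, 0 < r i) (hrsum : ∑ i, r i = 1)
    (Pmix : Kernel (∀ j, X j) (∀ j, X j)) [IsMarkovKernel Pmix]
    (hPmix : ∀ (x : ∀ j, X j) (A : Set (∀ j, X j)), MeasurableSet A →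
      Pmix x A = ∑ i, r i * K i x A)
    (ε : ℝ≥0∞) (hε : 0 < ε)
    (Q : Measure (∀ j, X j)) [IsProbabilityMeasure Q]
    (hminor : ∀ (x : ∀ j, X j) (A : Set (∀ j, X j)), MeasurableSet A →
      ε * Q A ≤ kComp K x A)
    (π : Measure (∀ j, X j)) [IsProbabilityMeasure π] (hinv : Kernel.Invariant Pmix π) :
    (∀ (x : ∀ j, X j) (A : Set (∀ j, X j)), MeasurableSet A →
        (∏ i, r i) * kComp K x A ≤ kIter Pmix d x A) ∧
    (∀ (x : ∀ j, X j) (A : Set (∀ j, X j)), MeasurableSet A →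
        ε * (∏ i, r i) * Q A ≤ kIter Pmix d x A) ∧
    (∀ (n : ℕ) (x : ∀ j, X j) (A : Set (∀ j, X j)), MeasurableSet A →
        |(kIter Pmix (n * d) x A).toReal - (π A).toReal| ≤
          (1 - (ε * ∏ i, r i).toReal) ^ n) := by
  have hle (i : Fin d) (x : ∀ j, X j) : r i • K i x ≤ Pmix x :=
    Measure.le_iff.2 fun A hA => by
      rw [hPmix x A hA]
      exact Finset.single_le_sum (f := fun i => r i * K i x A) (fun _ _ => zero_le)
        (Finset.mem_univ i)
  have hcomp (x : ∀ j, X j) (A : Set (∀ j, X j)) (hA : MeasurableSet A) :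
      (∏ i, r i) * kComp K x A ≤ kIter Pmix d x A :=
    prod_mul_kComp_le_kIter hle x hA
  have hminor' (x : ∀ j, X j) (A : Set (∀ j, X j)) (hA : MeasurableSet A) :
      ε * (∏ i, r i) * Q A ≤ kIter Pmix d x A := by
    refine le_trans ?_ (hcomp x A hA)
    rw [mul_comm ε, mul_assoc]
    gcongr
    exact hminor x A hA
  refine ⟨hcomp, hminor', fun n x A hA => ?_⟩
  rw [kIter_mul]
  exact abs_kIter_sub_invariant_le (fun x => Measure.le_iff.2 (hminor' x))
    (invariant_kIter hinv d) n x hA
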